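/- Let λ and x be real numbers and let r be a nonnegative integer. Then the series K_r(x|λ) = ∑_{n=0}^{∞} (x^n/n!)·(n)_{r,λ} converges and K_r(x|λ) = e^x · ∑_{j=0}^{r} x^j · {r brace j}_λ. -/

import Mathlib

/-- The degenerate falling factorial `(x)_{n,λ} = x(x-λ)⋯(x-(n-1)λ)`. -/
noncomputable def dff (lam x : ℝ) (n : ℕ) : ℝ := ∏ i ∈ Finset.range n, (x - i * lam)

/-- The degenerate Stirling number of the second kind
`{n brace k}_λ = (1/k!) ∑_{j=0}^{k} C(k,j) (-1)^{k-j} (j)_{n,λ}`. -/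
noncomputable def dstirling (lam : ℝ) (n k : ℕ) : ℝ :=
  (1 / (k.factorial : ℝ)) *
    ∑ j ∈ Finset.range (k + 1), (k.choose j : ℝ) * (-1) ^ (k - j) * dff lam (j : ℝ) n

/-- The generalized binomial coefficient `C(x,m) = x(x-1)⋯(x-m+1)/m!` with real upper argument. -/
noncomputable def gchoose (x : ℝ) (m : ℕ) : ℝ := (∏ i ∈ Finset.range m, (x - i)) / m.factorial

/-- Generalized binomial coefficient with integer lower argument; zero when the lower
argument is negative. -/
noncomputable def gchooseZ (x : ℝ) (m : ℤ) : ℝ := if 0 ≤ m then gchoose x m.toNat else 0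

/-- The degenerate falling factorial as a polynomial in `x`. -/
noncomputable def dffPoly (lam : ℝ) (n : ℕ) : Polynomial ℝ :=
  ∏ i ∈ Finset.range n, (Polynomial.X - Polynomial.C (i * lam))

theorem eval_dffPoly (lam x : ℝ) (n : ℕ) : (dffPoly lam n).eval x = dff lam x n := by
  simp [dffPoly, dff, Polynomial.eval_prod]

theorem natDegree_dffPoly (lam : ℝ) (n : ℕ) : (dffPoly lam n).natDegree = n := by
  unfold dffPoly
  rw [Polynomial.natDegree_prod_of_monic _ _ fun i _ => Polynomial.monic_X_sub_C _]
  simp only [Polynomial.natDegree_X_sub_C, Finset.sum_const, Finset.card_range, smul_eq_mul,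
    mul_one]

theorem fwdDiff_iter_dffPoly_zero (lam : ℝ) (n k : ℕ) :
    (fwdDiff (1 : ℝ))^[k] (dffPoly lam n).eval 0 = k.factorial * dstirling lam n k := by
  have hk : (k.factorial : ℝ) ≠ 0 := Nat.cast_ne_zero.2 k.factorial_ne_zero
  rw [fwdDiff_iter_eq_sum_shift, dstirling, ← mul_assoc, mul_one_div_cancel hk, one_mul]
  refine Finset.sum_congr rfl fun j _ => ?_
  simp only [zsmul_eq_mul, nsmul_eq_mul, mul_one, zero_add, eval_dffPoly]
  push_cast
  ring

theorem dstirling_eq_zero_of_lt (lam : ℝ) {n k : ℕ} (h : n < k) : dstirling lam n k = 0 := by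
  have hk : (k.factorial : ℝ) ≠ 0 := Nat.cast_ne_zero.2 k.factorial_ne_zero
  have h0 := fwdDiff_iter_dffPoly_zero lam n k
  rw [Polynomial.fwdDiff_iter_eq_zero_of_degree_lt
    (by rw [natDegree_dffPoly]; exact h)] at h0
  exact (mul_eq_zero.1 h0.symm).resolve_left hk

/-- Expansion of the degenerate falling factorial in ordinary falling factorials. -/
theorem dff_natCast_eq_sum (lam : ℝ) (n r : ℕ) :
    dff lam n r =
      ∑ k ∈ Finset.range (r + 1), (n.descFactorial k : ℝ) * dstirling lam r k := by
  have hshift := shift_eq_sum_fwdDiff_iter (1 : ℝ) (dffPoly lam r).eval n 0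
  simp only [zero_add, nsmul_eq_mul, mul_one, fwdDiff_iter_dffPoly_zero, ← mul_assoc] at hshift
  rw [eval_dffPoly] at hshift
  rw [hshift]
  have hterm (k : ℕ) : (n.choose k : ℝ) * k.factorial = n.descFactorial k := by
    rw [Nat.descFactorial_eq_factorial_mul_choose]
    push_cast
    ring
  simp only [hterm]
  rcases le_total n r with h | h
  · refine Finset.sum_subset (Finset.range_mono (by omega)) fun k _ hk => ?_
    rw [Nat.descFactorial_of_lt (by simpa using hk), Nat.cast_zero, zero_mul]
  · refine (Finset.sum_subset (Finset.range_mono (by omega)) fun k _ hk => ?_).symm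
    rw [dstirling_eq_zero_of_lt lam (by simpa using hk), mul_zero]

theorem hasSum_pow_div_factorial_mul_descFactorial (x : ℝ) (k : ℕ) :
    HasSum (fun n : ℕ => x ^ n / (n.factorial : ℝ) * (n.descFactorial k : ℝ))
      (x ^ k * Real.exp x) := by
  have hexp : HasSum (fun n : ℕ => x ^ n / (n.factorial : ℝ)) (Real.exp x) := by
    rw [Real.exp_eq_exp_ℝ]
    exact NormedSpace.expSeries_div_hasSum_exp x
  rw [← hasSum_nat_add_iff' k, Finset.sum_eq_zero, sub_zero]
  · refine (hexp.mul_left (x ^ k)).congr_fun fun n => ?_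
    have hfac : (n.factorial : ℝ) * (n + k).descFactorial k = (n + k).factorial := by
      have := Nat.factorial_mul_descFactorial (Nat.le_add_left k n)
      rw [Nat.add_sub_cancel] at this
      exact_mod_cast this
    have hn : (n.factorial : ℝ) ≠ 0 := Nat.cast_ne_zero.2 n.factorial_ne_zero
    have hnk : ((n + k).factorial : ℝ) ≠ 0 := Nat.cast_ne_zero.2 (n + k).factorial_ne_zero
    rw [div_mul_eq_mul_div, ← mul_div_assoc, div_eq_div_iff hnk hn, ← hfac]
    ring
  · intro n hn
    rw [Nat.descFactorial_of_lt (Finset.mem_range.1 hn), Nat.cast_zero, mul_zero]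

theorem hasSum_K (lam x : ℝ) (r : ℕ) :
    HasSum (fun n : ℕ => x ^ n / (n.factorial : ℝ) * dff lam (n : ℝ) r)
      (Real.exp x * ∑ j ∈ Finset.range (r + 1), x ^ j * dstirling lam r j) := by
  have h := hasSum_sum (s := Finset.range (r + 1)) fun k _ =>
    (hasSum_pow_div_factorial_mul_descFactorial x k).mul_right (dstirling lam r k)
  convert! h using 1
  · funext n
    rw [dff_natCast_eq_sum, Finset.mul_sum]
    exact Finset.sum_congr rfl fun k _ => (mul_assoc _ _ _).symm
  · rw [Finset.mul_sum]
    exact Finset.sum_congr rfl fun k _ => by ring
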